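/- arXiv:2510.08120 — 3 statements merged into one kernel-verified Lean document; each statement's English description precedes it below -/
import Mathlib

section
/- Let V be a type, I : ℕ, and let A : ℕ → (V → V → Prop), S : ℕ → Set V, l : ℕ → V satisfy, for every i < I: l i ∉ S i, S i is independent in A i, and A (i+1) = merge(A i, S i, l i). Let Q : V → V be the composition Q = q(S (I-1), l (I-1)) ∘ ⋯ ∘ q(S 0, l 0). Then Q is a digraph homomorphism from (V, A 0) to (V, A I): for all u v : V, if A 0 u v then A I (Q u) (Q v). (Lemma 1: G_0 maps homomorphically to the summarized explanation graph G_I.) -/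
/-- The merge map `q(S,l)`: sends every vertex of `S` to the label `l`, fixes others. -/
noncomputable def mergeMap {V : Type*} (S : Set V) (l : V) (v : V) : V :=
  open Classical in if v ∈ S then l else v

/-- One GloVE merging step: the merged arc relation `merge(A,S,l)`. -/
def mergeRel {V : Type*} (A : V → V → Prop) (S : Set V) (l : V) (u v : V) : Prop :=
  (u ∉ S ∧ v ∉ S ∧ A u v) ∨
  (u = l ∧ v ∉ S ∧ ∃ a ∈ S, A a v) ∨
  (v = l ∧ u ∉ S ∧ ∃ b ∈ S, A u b)

/-- `S` is independent in `A`: no arc of `A` has both endpoints in `S`. -/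
def Independent {V : Type*} (A : V → V → Prop) (S : Set V) : Prop :=
  ∀ a b, A a b → ¬(a ∈ S ∧ b ∈ S)

/-- Composition `q(S (i-1), l (i-1)) ∘ ⋯ ∘ q(S 0, l 0)` of the merge maps. -/
noncomputable def iterMergeMap {V : Type*} (S : ℕ → Set V) (l : ℕ → V) : ℕ → V → V
  | 0 => id
  | (i + 1) => mergeMap (S i) (l i) ∘ iterMergeMap S l i

/-- Merging an independent set is a digraph homomorphism onto the merged digraph. -/
theorem Independent.mergeRel_mergeMap {V : Type*} {A : V → V → Prop} {S : Set V}
    (hS : Independent A S) (l : V) {u v : V} (huv : A u v) :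
    mergeRel A S l (mergeMap S l u) (mergeMap S l v) := by
  have h := hS u v huv
  by_cases hu : u ∈ S
  · have hv : v ∉ S := fun hv => h ⟨hu, hv⟩
    simp only [mergeMap, if_pos hu, if_neg hv]
    exact Or.inr (Or.inl ⟨rfl, hv, u, hu, huv⟩)
  · by_cases hv : v ∈ S
    · simp only [mergeMap, if_neg hu, if_pos hv]
      exact Or.inr (Or.inr ⟨rfl, hu, v, hv, huv⟩)
    · simp only [mergeMap, if_neg hu, if_neg hv]
      exact Or.inl ⟨hu, hv, huv⟩

/-- Lemma 1: `G₀` maps homomorphically to the summarized explanation graph `G_I`. -/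
theorem iterMergeMap_hom {V : Type*} (I : ℕ) (A : ℕ → (V → V → Prop))
    (S : ℕ → Set V) (l : ℕ → V)
    (hl : ∀ i < I, l i ∉ S i)
    (hind : ∀ i < I, Independent (A i) (S i))
    (hstep : ∀ i < I, A (i + 1) = mergeRel (A i) (S i) (l i)) :
    ∀ u v : V, A 0 u v → A I (iterMergeMap S l I u) (iterMergeMap S l I v) := by
  intro u v huv
  induction I with
  | zero => exact huv
  | succ i ih =>
    rw [hstep i i.lt_succ_self]
    exact (hind i i.lt_succ_self).mergeRel_mergeMap (l i)
      (ih (fun j hj => hl j (hj.trans i.lt_succ_self))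
        (fun j hj => hind j (hj.trans i.lt_succ_self))
        (fun j hj => hstep j (hj.trans i.lt_succ_self)))
end

section
/- Let V be a type, K : ℕ, I : ℕ, and let A : ℕ → (V → V → Prop), S : ℕ → Set V, l : ℕ → V, k : ℕ → Fin K and a coloring c : V → Fin K satisfy: c is proper for A 0, and for every i < I: l i ∉ S i, every vertex of S i has color k i, c (l i) = k i, and A (i+1) = merge(A i, S i, l i). Then c is proper for A I: for all u v, if A I u v then c u ≠ c v. (The K-partite structure is preserved through all GloVE iterations.) -/
/-- Merging a set of vertices of one color into a label of that color keeps a coloring proper. -/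
theorem mergeRel_proper_coloring {V C : Type*} {A : V → V → Prop} {S : Set V} {l : V}
    {c : V → C} (hA : ∀ u v, A u v → c u ≠ c v) (hS : ∀ v ∈ S, c v = c l) :
    ∀ u v, mergeRel A S l u v → c u ≠ c v := by
  rintro u v (⟨-, -, h⟩ | ⟨rfl, -, a, ha, h⟩ | ⟨rfl, -, b, hb, h⟩)
  · exact hA u v h
  · exact hS a ha ▸ hA a v h
  · exact hS b hb ▸ hA u b h

/-- The K-partite structure is preserved through all GloVE iterations. -/
theorem iter_mergeRel_proper_coloring {V : Type*} (K : ℕ) (I : ℕ)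
    (A : ℕ → (V → V → Prop)) (S : ℕ → Set V) (l : ℕ → V) (k : ℕ → Fin K)
    (c : V → Fin K)
    (hproper : ∀ u v, A 0 u v → c u ≠ c v)
    (hl : ∀ i < I, l i ∉ S i)
    (hS : ∀ i < I, ∀ v ∈ S i, c v = k i)
    (hcl : ∀ i < I, c (l i) = k i)
    (hstep : ∀ i < I, A (i + 1) = mergeRel (A i) (S i) (l i)) :
    ∀ u v, A I u v → c u ≠ c v := by
  induction I with
  | zero => exact hproper
  | succ n ih =>
    have hn := n.lt_succ_self
    rw [hstep n hn]
    refine mergeRel_proper_coloring ?_ fun v hv => (hS n hn v hv).trans (hcl n hn).symm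
    exact ih (fun i hi => hl i (hi.trans hn)) (fun i hi => hS i (hi.trans hn))
      (fun i hi => hcl i (hi.trans hn)) (fun i hi => hstep i (hi.trans hn))
end

section
/- Let V be a type, K : ℕ, I : ℕ, and let A : ℕ → (V → V → Prop), S : ℕ → Set V, l : ℕ → V, k : ℕ → Fin K and a coloring c : V → Fin K satisfy: c is proper for A 0, and for every i < I: l i ∉ S i, every vertex of S i has color k i, c (l i) = k i, and A (i+1) = merge(A i, S i, l i). Let Q : V → V be the composition Q = q(S (I-1), l (I-1)) ∘ ⋯ ∘ q(S 0, l 0). Then the arcs of the final graph are exactly the images of the arcs of the initial graph: for all u' v' : V, A I u' v' holds if and only if there exist a b : V with A 0 a b, Q a = u' and Q b = v' (i.e. A I = Relation.Map (A 0) Q Q). -/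
/-- Merging a vertex set that is independent in `A` yields the image of `A` under the merge map. -/
theorem mergeRel_eq_map {V : Type*} {A : V → V → Prop} {S : Set V} {l : V}
    (h : Independent A S) :
    mergeRel A S l = Relation.Map A (mergeMap S l) (mergeMap S l) := by
  ext u v
  constructor
  · rintro (⟨hu, hv, huv⟩ | ⟨rfl, hv, a, ha, hav⟩ | ⟨rfl, hu, b, hb, hub⟩)
    · exact ⟨u, v, huv, by simp [mergeMap, hu], by simp [mergeMap, hv]⟩
    · exact ⟨a, v, hav, by simp [mergeMap, ha], by simp [mergeMap, hv]⟩
    · exact ⟨u, b, hub, by simp [mergeMap, hu], by simp [mergeMap, hb]⟩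
  · rintro ⟨a, b, hab, rfl, rfl⟩
    have hnot := h a b hab
    by_cases ha : a ∈ S <;> by_cases hb : b ∈ S
    · exact absurd ⟨ha, hb⟩ hnot
    · exact Or.inr (Or.inl ⟨by simp [mergeMap, ha], by simp [mergeMap, hb],
        a, ha, by simpa [mergeMap, hb] using hab⟩)
    · exact Or.inr (Or.inr ⟨by simp [mergeMap, hb], by simp [mergeMap, ha],
        b, hb, by simpa [mergeMap, ha] using hab⟩)
    · exact Or.inl (by simpa [mergeMap, ha, hb] using hab)

/-- Merging vertices into a label of the same color preserves colors. -/
theorem color_mergeMap {V C : Type*} {c : V → C} {S : Set V} {l : V}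
    (h : ∀ v ∈ S, c v = c l) (v : V) : c (mergeMap S l v) = c v := by
  by_cases hv : v ∈ S
  · simp [mergeMap, hv, h v hv]
  · simp [mergeMap, hv]

/-- Iterated merging of vertices into labels of the same color preserves colors. -/
theorem color_iterMergeMap {V C : Type*} {c : V → C} {S : ℕ → Set V} {l : ℕ → V} {n : ℕ}
    (h : ∀ i < n, ∀ v ∈ S i, c v = c (l i)) (v : V) : c (iterMergeMap S l n v) = c v := by
  induction n with
  | zero => rfl
  | succ n ih =>
    exact (color_mergeMap (h n n.lt_succ_self) _).trans
      (ih fun i hi => h i (hi.trans n.lt_succ_self))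

/-- The arcs of the final graph are exactly the images of the arcs of the
initial graph under the composed merge map. -/
theorem iter_mergeRel_eq_map {V : Type*} (K : ℕ) (I : ℕ)
    (A : ℕ → (V → V → Prop)) (S : ℕ → Set V) (l : ℕ → V) (k : ℕ → Fin K)
    (c : V → Fin K)
    (hproper : ∀ u v, A 0 u v → c u ≠ c v)
    (hl : ∀ i < I, l i ∉ S i)
    (hS : ∀ i < I, ∀ v ∈ S i, c v = k i)
    (hcl : ∀ i < I, c (l i) = k i)
    (hstep : ∀ i < I, A (i + 1) = mergeRel (A i) (S i) (l i)) :
    A I = Relation.Map (A 0) (iterMergeMap S l I) (iterMergeMap S l I) := by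
  have hcolor : ∀ i < I, ∀ v ∈ S i, c v = c (l i) := fun i hi v hv =>
    (hS i hi v hv).trans (hcl i hi).symm
  suffices h : ∀ n ≤ I, A n = Relation.Map (A 0) (iterMergeMap S l n) (iterMergeMap S l n) from
    h I le_rfl
  intro n
  induction n with
  | zero => exact fun _ => (Relation.map_id_id (A 0)).symm
  | succ n ih =>
    intro hn
    have hA := ih (Nat.le_of_succ_le hn)
    have hind : Independent (A n) (S n) := by
      rw [hA]
      rintro _ _ ⟨a, b, hab, rfl, rfl⟩ ⟨ha, hb⟩
      have hlt : ∀ i < n, ∀ v ∈ S i, c v = c (l i) := fun i hi => hcolor i (hi.trans hn)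
      apply hproper a b hab
      rw [← color_iterMergeMap hlt a, ← color_iterMergeMap hlt b, hS n hn _ ha, hS n hn _ hb]
    rw [hstep n hn, mergeRel_eq_map hind, hA, Relation.map_map]
    rfl
end
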